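/- Receiver reaps the full informational surplus (pure-strategy case): Suppose n ≥ 2 and Assumptions 1 and 2 hold. In every pure Nash equilibrium (π_1,…,π_n) of the persuasion game with the uniform tie-breaking decision rule, the receiver's expected equilibrium payoff equals E_{μ_0}[max_{a∈A} u_R(a, ω_R)]. -/

import Mathlib

open Finset

namespace Persuasion

variable {n : ℕ} {A ΩR : Type} {Ω : Fin n → Type}
variable [Fintype A] [Fintype ΩR] [∀ k, Fintype (Ω k)]
variable [DecidableEq ΩR] [∀ k, DecidableEq (Ω k)]

/-- A signal for sender `k`: a map from `k`'s and the receiver's states to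
distributions over messages/actions. -/
def IsSignal {k : Fin n} (π : Ω k × ΩR → A → ℝ) : Prop :=
  (∀ s a, 0 ≤ π s a) ∧ ∀ s, ∑ a, π s a = 1

/-- The joint distribution on `Ω × A` induced by the prior `μ0` and sender `k`'s signal `π`. -/
def jointP (μ0 : ((∀ k, Ω k) × ΩR) → ℝ) {k : Fin n}
    (π : Ω k × ΩR → A → ℝ) (ω : (∀ k, Ω k) × ΩR) (a : A) : ℝ :=
  μ0 ω * π (ω.1 k, ω.2) a

/-- The probability that the signal `π` is realized as the message `a`. -/
def Pmsg (μ0 : ((∀ k, Ω k) × ΩR) → ℝ) {k : Fin n}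
    (π : Ω k × ΩR → A → ℝ) (a : A) : ℝ :=
  ∑ ω, jointP μ0 π ω a

/-- The joint probability that `(ω_i, ω_R) = (ωi, ωR)` and the message is `a`. -/
def margIR (μ0 : ((∀ k, Ω k) × ΩR) → ℝ) {k : Fin n}
    (π : Ω k × ΩR → A → ℝ) (i : Fin n) (ωi : Ω i) (ωR : ΩR) (a : A) : ℝ :=
  ∑ ω ∈ univ.filter (fun ω : (∀ k, Ω k) × ΩR => ω.1 i = ωi ∧ ω.2 = ωR), jointP μ0 π ω a

/-- The joint probability that `ω_i = ωi` and the message is `a`. -/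
def margI (μ0 : ((∀ k, Ω k) × ΩR) → ℝ) {k : Fin n}
    (π : Ω k × ΩR → A → ℝ) (i : Fin n) (ωi : Ω i) (a : A) : ℝ :=
  ∑ ω ∈ univ.filter (fun ω : (∀ k, Ω k) × ΩR => ω.1 i = ωi), jointP μ0 π ω a

/-- The joint probability that `ω_R = ωR` and the message is `a`. -/
def margR (μ0 : ((∀ k, Ω k) × ΩR) → ℝ) {k : Fin n}
    (π : Ω k × ΩR → A → ℝ) (ωR : ΩR) (a : A) : ℝ :=
  ∑ ω ∈ univ.filter (fun ω : (∀ k, Ω k) × ΩR => ω.2 = ωR), jointP μ0 π ω a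

/-- The posterior probability of `(ω_i, ω_R) = (ωi, ωR)` given that the message is `a`. -/
noncomputable def posterior (μ0 : ((∀ k, Ω k) × ΩR) → ℝ) {k : Fin n}
    (π : Ω k × ΩR → A → ℝ) (i : Fin n) (ωi : Ω i) (ωR : ΩR) (a : A) : ℝ :=
  margIR μ0 π i ωi ωR a / Pmsg μ0 π a

/-- `E[u_R(b, ω_R) | π = a]`. -/
noncomputable def condExpR (μ0 : ((∀ k, Ω k) × ΩR) → ℝ) {k : Fin n}
    (π : Ω k × ΩR → A → ℝ) (uR : A → ΩR → ℝ) (a b : A) : ℝ :=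
  (∑ ω, jointP μ0 π ω a * uR b ω.2) / Pmsg μ0 π a

/-- Incentive compatibility: each realized message `a` is an optimal action for the
receiver given the posterior it induces. -/
def IC (μ0 : ((∀ k, Ω k) × ΩR) → ℝ) {k : Fin n}
    (π : Ω k × ΩR → A → ℝ) (uR : A → ΩR → ℝ) : Prop :=
  ∀ a, 0 < Pmsg μ0 π a → ∀ b, condExpR μ0 π uR a b ≤ condExpR μ0 π uR a a

/-- The receiver's expected utility `E[u_R(a, ω_R)]` from following the signal `π`. -/
def vR (μ0 : ((∀ k, Ω k) × ΩR) → ℝ) {k : Fin n}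
    (π : Ω k × ΩR → A → ℝ) (uR : A → ΩR → ℝ) : ℝ :=
  ∑ a, ∑ ω, jointP μ0 π ω a * uR a ω.2

/-- Sender `i`'s expected utility `E[u_i(a, ω_i)]` when the receiver follows signal `π`
(of sender `k`). -/
def vS (μ0 : ((∀ k, Ω k) × ΩR) → ℝ) {k : Fin n}
    (π : Ω k × ΩR → A → ℝ) (i : Fin n) (ui : A → Ω i → ℝ) : ℝ :=
  ∑ a, ∑ ω, jointP μ0 π ω a * ui a (ω.1 i)

/-- The set of maximizers of `u` over `A`. -/
noncomputable def argmaxSet (u : A → ℝ) : Finset A :=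
  univ.filter (fun a => ∀ b, u b ≤ u a)

/-- A signal is fully informative if any realized message `a`, in any receiver state `ωR`
that has positive probability jointly with `a`, is the receiver's unique optimal action. -/
noncomputable def FullyInformative (μ0 : ((∀ k, Ω k) × ΩR) → ℝ) {k : Fin n}
    (π : Ω k × ΩR → A → ℝ) (uR : A → ΩR → ℝ) : Prop :=
  ∀ a ωR, 0 < margR μ0 π ωR a → argmaxSet (fun b => uR b ωR) = {a}

/-- Assumption 1: every player has a unique optimal action in each of his states. -/
noncomputable def Assumption1 (uR : A → ΩR → ℝ) (u : ∀ k : Fin n, A → Ω k → ℝ) : Prop :=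
  (∀ ωR, (argmaxSet (fun a => uR a ωR)).card = 1) ∧
  ∀ (k : Fin n) (ωk : Ω k), (argmaxSet (fun a => u k a ωk)).card = 1

/-- Assumption 2: conditional on any positive-probability `(ω_j, ω_R)`, any other sender `i`
has, with positive probability, a state in which his preferences agree with the receiver's. -/
noncomputable def Assumption2 (μ0 : ((∀ k, Ω k) × ΩR) → ℝ) (uR : A → ΩR → ℝ)
    (u : ∀ k : Fin n, A → Ω k → ℝ) : Prop :=
  ∀ i j : Fin n, i ≠ j → ∀ (ωj : Ω j) (ωR : ΩR),
    (0 < ∑ ω ∈ univ.filter (fun ω : (∀ k, Ω k) × ΩR => ω.1 j = ωj ∧ ω.2 = ωR), μ0 ω) →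
    ∃ ωi : Ω i,
      (0 < ∑ ω ∈ univ.filter
        (fun ω : (∀ k, Ω k) × ΩR => ω.1 i = ωi ∧ ω.1 j = ωj ∧ ω.2 = ωR), μ0 ω) ∧
      argmaxSet (fun a => u i a ωi) = argmaxSet (fun a => uR a ωR)

/-- `E_{μ0}[max_{a ∈ A} u_R(a, ω_R)]`: the receiver's first-best expected utility. -/
noncomputable def Emax [Nonempty A] (μ0 : ((∀ k, Ω k) × ΩR) → ℝ) (uR : A → ΩR → ℝ) : ℝ :=
  ∑ ω : (∀ k, Ω k) × ΩR, μ0 ω * univ.sup' univ_nonempty (fun a => uR a ω.2)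

/-- The set of senders whose signals the receiver weakly prefers to all others. -/
noncomputable def BestSet (μ0 : ((∀ k, Ω k) × ΩR) → ℝ)
    (π : ∀ k : Fin n, Ω k × ΩR → A → ℝ) (uR : A → ΩR → ℝ) : Finset (Fin n) :=
  univ.filter (fun j => ∀ k, vR μ0 (π k) uR ≤ vR μ0 (π j) uR)

/-- Sender `i`'s expected payoff under the uniform tie-breaking decision rule. -/
noncomputable def senderPayoff (μ0 : ((∀ k, Ω k) × ΩR) → ℝ)
    (π : ∀ k : Fin n, Ω k × ΩR → A → ℝ) (uR : A → ΩR → ℝ)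
    (i : Fin n) (ui : A → Ω i → ℝ) : ℝ :=
  (∑ j ∈ BestSet μ0 π uR, vS μ0 (π j) i ui) / (BestSet μ0 π uR).card

/-- A pure Nash equilibrium of the persuasion game with the uniform tie-breaking rule. -/
noncomputable def PureNE (μ0 : ((∀ k, Ω k) × ΩR) → ℝ)
    (π : ∀ k : Fin n, Ω k × ΩR → A → ℝ) (uR : A → ΩR → ℝ)
    (u : ∀ k : Fin n, A → Ω k → ℝ) : Prop :=
  (∀ k, IsSignal (π k) ∧ IC μ0 (π k) uR) ∧
  ∀ (i : Fin n) (π' : Ω i × ΩR → A → ℝ), IsSignal π' → IC μ0 π' uR →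
    senderPayoff μ0 (Function.update π i π') uR i (u i) ≤ senderPayoff μ0 π uR i (u i)


/-- An optimal decision rule: for each profile of IC signals, a distribution over senders
supported on senders whose signals the receiver weakly prefers to all others. -/
def IsOptimalRule (μ0 : ((∀ k, Ω k) × ΩR) → ℝ) (uR : A → ΩR → ℝ)
    (D : (∀ k : Fin n, Ω k × ΩR → A → ℝ) → Fin n → ℝ) : Prop :=
  ∀ π : ∀ k : Fin n, Ω k × ΩR → A → ℝ,
    (∀ k, IsSignal (π k) ∧ IC μ0 (π k) uR) →
    (∀ j, 0 ≤ D π j) ∧ (∑ j, D π j = 1) ∧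
    ∀ i, 0 < D π i → ∀ j, vR μ0 (π j) uR ≤ vR μ0 (π i) uR

/-- Sender `i`'s expected payoff from profile `π` under decision rule `D`. -/
def payoffUnder (μ0 : ((∀ k, Ω k) × ΩR) → ℝ)
    (D : (∀ k : Fin n, Ω k × ΩR → A → ℝ) → Fin n → ℝ)
    (π : ∀ k : Fin n, Ω k × ΩR → A → ℝ) (i : Fin n) (ui : A → Ω i → ℝ) : ℝ :=
  ∑ j, D π j * vS μ0 (π j) i ui

/-- A pure pessimistic Nash equilibrium: a profile of IC signals together with an optimal
decision rule `D` such that every unilateral IC deviation of a sender is unprofitable under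
*some* optimal decision rule after the deviation. -/
def PessimisticNE (μ0 : ((∀ k, Ω k) × ΩR) → ℝ)
    (π : ∀ k : Fin n, Ω k × ΩR → A → ℝ) (uR : A → ΩR → ℝ)
    (u : ∀ k : Fin n, A → Ω k → ℝ)
    (D : (∀ k : Fin n, Ω k × ΩR → A → ℝ) → Fin n → ℝ) : Prop :=
  (∀ k, IsSignal (π k) ∧ IC μ0 (π k) uR) ∧
  IsOptimalRule μ0 uR D ∧
  ∀ (i : Fin n) (π' : Ω i × ΩR → A → ℝ), IsSignal π' → IC μ0 π' uR →
    ∃ D', IsOptimalRule μ0 uR D' ∧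
      payoffUnder μ0 D' (Function.update π i π') i (u i) ≤ payoffUnder μ0 D π i (u i)

/-- A finite joint distribution `p` of `(x, y, a)` for which `a` is an optimal action given its
posterior on `y`, and in which every realized `(y, a)` has a realized `x` agreeing with the
receiver, admits a modification with the same marginal on `(x, y)` that keeps this optimality and
is strictly better for both parties, provided some realized action is suboptimal. -/
lemma exists_improved_joint {X Y A : Type} [Fintype X] [Fintype Y] [Fintype A]
    [Nonempty X] [Nonempty Y] [Nonempty A]
    (p : X → Y → A → ℝ) (hp : ∀ x y a, 0 ≤ p x y a)
    (w : A → Y → ℝ) (v : A → X → ℝ) (star : Y → A)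
    (hstar : ∀ y a, a ≠ star y → w a y < w (star y) y)
    (halign : ∀ y a, (∃ x, 0 < p x y a) →
      ∃ x, 0 < p x y a ∧ ∀ b, b ≠ star y → v b x < v (star y) x)
    (hIC : ∀ a b, ∑ x, ∑ y, p x y a * w b y ≤ ∑ x, ∑ y, p x y a * w a y)
    (hne : ∃ x y a, 0 < p x y a ∧ a ≠ star y) :
    ∃ q : X → Y → A → ℝ, (∀ x y a, 0 ≤ q x y a) ∧
      (∀ x y, ∑ a, q x y a = ∑ a, p x y a) ∧
      (∀ a b, ∑ x, ∑ y, q x y a * w b y ≤ ∑ x, ∑ y, q x y a * w a y) ∧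
      (∑ a, ∑ x, ∑ y, p x y a * w a y < ∑ a, ∑ x, ∑ y, q x y a * w a y) ∧
      (∑ a, ∑ x, ∑ y, p x y a * v a x < ∑ a, ∑ x, ∑ y, q x y a * v a x) := by
  classical
  set R : Y → A → ℝ := fun y a => ∑ x, p x y a with hR
  have hR0 : ∀ y a, 0 ≤ R y a := fun y a => sum_nonneg fun x _ => hp x y a
  have hpR : ∀ x y a, p x y a ≤ R y a := fun x y a =>
    single_le_sum (f := fun x => p x y a) (fun x _ => hp x y a) (mem_univ x)
  have hc' : ∀ y a, ∃ x, 0 < R y a →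
      0 < p x y a ∧ ∀ b, b ≠ star y → v b x < v (star y) x := by
    intro y a
    by_cases h : ∃ x, 0 < p x y a
    · obtain ⟨x, hx⟩ := halign y a h
      exact ⟨x, fun _ => hx⟩
    · push Not at h
      refine ⟨Classical.arbitrary X, fun h' => ?_⟩
      exact absurd h' (not_lt.2 (sum_nonpos fun x _ => h x))
  choose c hc using hc'
  obtain ⟨ε, hε0, hε1, hε⟩ : ∃ ε : ℝ, 0 < ε ∧ ε ≤ 1 ∧
      ∀ y a, ε * R y a ≤ p (c y a) y a := by
    set t : Y × A → ℝ :=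
      fun z => if 0 < R z.1 z.2 then p (c z.1 z.2) z.1 z.2 / R z.1 z.2 else 1 with ht
    obtain ⟨z, hz⟩ := Finite.exists_min t
    refine ⟨t z, ?_, ?_, fun y a => ?_⟩
    · simp only [ht]
      split_ifs with h
      · exact div_pos (hc _ _ h).1 h
      · exact one_pos
    · simp only [ht]
      split_ifs with h
      · exact div_le_one_of_le₀ (hpR _ _ _) h.le
      · exact le_rfl
    · by_cases h : 0 < R y a
      · have := hz (y, a)
        rwa [show t (y, a) = p (c y a) y a / R y a from if_pos h, le_div_iff₀ h] at this
      · rw [le_antisymm (not_lt.1 h) (hR0 y a), mul_zero]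
        exact hp _ _ _
  set d : X → Y → A → ℝ := fun x y a => if x = c y a then ε * R y a else 0 with hd
  have hd0 : ∀ x y a, 0 ≤ d x y a := by
    intro x y a
    simp only [hd]
    split_ifs
    · exact mul_nonneg hε0.le (hR0 y a)
    · exact le_rfl
  have hdp : ∀ x y a, d x y a ≤ p x y a := by
    intro x y a
    simp only [hd]
    split_ifs with h
    · rw [h]; exact hε y a
    · exact hp x y a
  have hdsum : ∀ (a : A) (g : Y → ℝ),
      ∑ x, ∑ y, d x y a * g y = ε * ∑ x, ∑ y, p x y a * g y := by
    intro a g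
    rw [sum_comm, sum_comm (f := fun x y => p x y a * g y), mul_sum]
    refine sum_congr rfl fun y _ => ?_
    rw [← sum_mul, ← sum_mul]
    simp [hd, hR, mul_assoc]
  set q : X → Y → A → ℝ := fun x y a =>
    p x y a - d x y a + (if a = star y then ∑ b, d x y b else 0) with hq
  have hgain : ∀ f : A → X → Y → ℝ, ∑ a, ∑ x, ∑ y, q x y a * f a x y
      = ∑ a, ∑ x, ∑ y, p x y a * f a x y
        + ∑ x, ∑ y, ∑ a, d x y a * (f (star y) x y - f a x y) := by
    intro f
    have hswap : ∀ r : X → Y → A → ℝ, ∑ a, ∑ x, ∑ y, r x y a * f a x y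
        = ∑ x, ∑ y, ∑ a, r x y a * f a x y := by
      intro r
      rw [sum_comm]
      exact sum_congr rfl fun x _ => sum_comm
    rw [hswap, hswap, ← sum_add_distrib]
    refine sum_congr rfl fun x _ => ?_
    rw [← sum_add_distrib]
    refine sum_congr rfl fun y _ => ?_
    simp only [hq, add_mul, sub_mul, ite_mul, zero_mul, sum_add_distrib, sum_sub_distrib,
      mul_sub, sum_ite_eq', mem_univ, if_true, sum_mul]
    ring
  have hstrict : ∀ f : A → X → Y → ℝ,
      (∀ x y, (∃ a, 0 < d x y a) → ∀ b, b ≠ star y → f b x y < f (star y) x y) →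
      ∑ a, ∑ x, ∑ y, p x y a * f a x y < ∑ a, ∑ x, ∑ y, q x y a * f a x y := by
    intro f hf
    rw [hgain]
    have hterm : ∀ x y a, 0 ≤ d x y a * (f (star y) x y - f a x y) := by
      intro x y a
      rcases (hd0 x y a).eq_or_lt with h | h
      · rw [← h, zero_mul]
      · by_cases ha : a = star y
        · rw [ha, sub_self, mul_zero]
        · exact mul_nonneg h.le (sub_nonneg.2 (hf x y ⟨a, h⟩ a ha).le)
    obtain ⟨x, y, a, hpos, ha⟩ := hne
    have hdpos : 0 < d (c y a) y a := by
      simp only [hd, if_true]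
      exact mul_pos hε0 (hpos.trans_le (hpR x y a))
    refine lt_add_of_pos_right _ ?_
    refine sum_pos' (fun x _ => sum_nonneg fun y _ => sum_nonneg fun a _ => hterm x y a)
      ⟨c y a, mem_univ _, ?_⟩
    refine sum_pos' (fun y _ => sum_nonneg fun a _ => hterm _ y a) ⟨y, mem_univ _, ?_⟩
    refine sum_pos' (fun a _ => hterm _ _ a) ⟨a, mem_univ _, ?_⟩
    exact mul_pos hdpos (sub_pos.2 (hf _ y ⟨a, hdpos⟩ a ha))
  refine ⟨q, ?_, ?_, ?_, hstrict (fun a _ y => w a y) fun x y _ => hstar y,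
    hstrict (fun a x _ => v a x) ?_⟩
  · intro x y a
    refine add_nonneg (sub_nonneg.2 (hdp x y a)) ?_
    split_ifs
    · exact sum_nonneg fun b _ => hd0 x y b
    · exact le_rfl
  · intro x y
    simp [hq, sum_add_distrib]
  · intro a b
    rw [← sub_nonneg]
    have key : ∑ x, ∑ y, q x y a * w a y - ∑ x, ∑ y, q x y a * w b y
        = (1 - ε) * (∑ x, ∑ y, p x y a * w a y - ∑ x, ∑ y, p x y a * w b y)
          + ∑ x, ∑ y, (if a = star y then ∑ b, d x y b else 0) * (w a y - w b y) := by
      have h1 := hdsum a (fun y => w a y)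
      have h2 := hdsum a (fun y => w b y)
      simp only [hq, add_mul, sub_mul, mul_sub, sum_add_distrib, sum_sub_distrib]
      linarith
    rw [key]
    refine add_nonneg (mul_nonneg (sub_nonneg.2 hε1) (sub_nonneg.2 (hIC a b))) ?_
    refine sum_nonneg fun x _ => sum_nonneg fun y _ => ?_
    split_ifs with h
    · refine mul_nonneg (sum_nonneg fun b _ => hd0 x y b) (sub_nonneg.2 ?_)
      by_cases hb : b = star y
      · rw [h, hb]
      · rw [h]; exact (hstar y b hb).le
    · rw [zero_mul]
  · rintro x y ⟨a, ha⟩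
    simp only [hd] at ha
    split_ifs at ha with h
    · rw [h]
      exact (hc y a (pos_of_mul_pos_right ha hε0.le)).2
    · exact absurd ha (lt_irrefl _)

lemma jointP_nonneg {μ0 : ((∀ k, Ω k) × ΩR) → ℝ} (hμ0 : ∀ ω, 0 ≤ μ0 ω) {k : Fin n}
    {π : Ω k × ΩR → A → ℝ} (hπ : IsSignal π) (ω : (∀ k, Ω k) × ΩR) (a : A) :
    0 ≤ jointP μ0 π ω a :=
  mul_nonneg (hμ0 ω) (hπ.1 _ a)

/-- Incentive compatibility in terms of unnormalized conditional expectations. -/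
lemma IC_iff {μ0 : ((∀ k, Ω k) × ΩR) → ℝ} (hμ0 : ∀ ω, 0 ≤ μ0 ω) {k : Fin n}
    {π : Ω k × ΩR → A → ℝ} (hπ : IsSignal π) (uR : A → ΩR → ℝ) :
    IC μ0 π uR ↔ ∀ a b, ∑ ω, jointP μ0 π ω a * uR b ω.2 ≤ ∑ ω, jointP μ0 π ω a * uR a ω.2 := by
  have h0 : ∀ a, 0 ≤ Pmsg μ0 π a := fun a => sum_nonneg fun ω _ => jointP_nonneg hμ0 hπ ω a
  constructor
  · intro h a b
    rcases (h0 a).eq_or_lt with ha | ha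
    · have hz : ∀ ω, jointP μ0 π ω a = 0 := fun ω =>
        (sum_eq_zero_iff_of_nonneg fun ω _ => jointP_nonneg hμ0 hπ ω a).1 ha.symm ω (mem_univ ω)
      simp [hz]
    · exact (div_le_div_iff_of_pos_right ha).1 (h a ha b)
  · intro h a ha b
    exact (div_le_div_iff_of_pos_right ha).2 (h a b)

lemma sum_jointP_mul (μ0 : ((∀ k, Ω k) × ΩR) → ℝ) {k : Fin n} (π : Ω k × ΩR → A → ℝ)
    (i : Fin n) (a : A) (g : Ω i → ΩR → ℝ) :
    ∑ ω, jointP μ0 π ω a * g (ω.1 i) ω.2 = ∑ x, ∑ y, margIR μ0 π i x y a * g x y := by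
  rw [← Fintype.sum_prod_type' (f := fun x y => margIR μ0 π i x y a * g x y),
    ← sum_fiberwise (s := univ) (g := fun ω : (∀ k, Ω k) × ΩR => (ω.1 i, ω.2))]
  refine sum_congr rfl fun s _ => ?_
  rw [margIR, sum_mul]
  refine sum_congr (by ext ω; simp [Prod.ext_iff]) fun ω hω => ?_
  simp only [mem_filter, mem_univ, true_and] at hω
  rw [hω.1, hω.2]

lemma sum_margIR (μ0 : ((∀ k, Ω k) × ΩR) → ℝ) {k : Fin n} {π : Ω k × ΩR → A → ℝ}
    (hπ : IsSignal π) (i : Fin n) (x : Ω i) (y : ΩR) :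
    ∑ a, margIR μ0 π i x y a
      = ∑ ω ∈ univ.filter (fun ω : (∀ k, Ω k) × ΩR => ω.1 i = x ∧ ω.2 = y), μ0 ω := by
  simp only [margIR, jointP]
  rw [sum_comm]
  refine sum_congr rfl fun ω _ => ?_
  rw [← mul_sum, hπ.2, mul_one]

/-- Every joint distribution of `(ω_i, ω_R, a)` with the prior marginal on `(ω_i, ω_R)` comes
from a signal of sender `i`. -/
lemma exists_signal_of_joint {μ0 : ((∀ k, Ω k) × ΩR) → ℝ}
    {i : Fin n} (π₀ : Ω i × ΩR → A → ℝ) (hπ₀ : IsSignal π₀)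
    (q : Ω i → ΩR → A → ℝ) (hq : ∀ x y a, 0 ≤ q x y a)
    (hsum : ∀ x y, ∑ a, q x y a
      = ∑ ω ∈ univ.filter (fun ω : (∀ k, Ω k) × ΩR => ω.1 i = x ∧ ω.2 = y), μ0 ω) :
    ∃ π' : Ω i × ΩR → A → ℝ, IsSignal π' ∧ ∀ x y a, margIR μ0 π' i x y a = q x y a := by
  classical
  refine ⟨fun s a => if ∑ b, q s.1 s.2 b = 0 then π₀ s a
    else q s.1 s.2 a / ∑ b, q s.1 s.2 b, ⟨fun s a => ?_, fun s => ?_⟩, fun x y a => ?_⟩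
  · dsimp only
    split_ifs
    · exact hπ₀.1 s a
    · exact div_nonneg (hq _ _ _) (sum_nonneg fun b _ => hq _ _ b)
  · dsimp only
    split_ifs with h
    · exact hπ₀.2 s
    · rw [← sum_div, div_self h]
  · have hmarg : ∀ π' : Ω i × ΩR → A → ℝ,
        margIR μ0 π' i x y a = (∑ b, q x y b) * π' (x, y) a := by
      intro π'
      rw [hsum, margIR, sum_mul]
      refine sum_congr rfl fun ω hω => ?_
      simp only [mem_filter, mem_univ, true_and] at hω
      rw [jointP, hω.1, hω.2]
    rw [hmarg]
    dsimp only
    split_ifs with h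
    · rw [h, zero_mul,
        (sum_eq_zero_iff_of_nonneg fun b _ => hq x y b).1 h a (mem_univ a)]
    · rw [mul_div_cancel₀ _ h]

lemma exists_unique_maximizer {u : A → ℝ} (h : (argmaxSet u).card = 1) :
    ∃ s, argmaxSet u = {s} ∧ ∀ a, a ≠ s → u a < u s := by
  obtain ⟨s, hs⟩ := card_eq_one.1 h
  have hmem : ∀ b, u b ≤ u s := by
    have : s ∈ argmaxSet u := hs ▸ mem_singleton_self s
    simpa [argmaxSet] using this
  refine ⟨s, hs, fun a ha => lt_of_not_ge fun hle => ha ?_⟩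
  have : a ∈ argmaxSet u := by
    simpa [argmaxSet] using fun b => (hmem b).trans hle
  rwa [hs, mem_singleton] at this

/-- `E[max u_R] - v_R` is the expected regret of the receiver. -/
lemma Emax_eq_sum_jointP [Nonempty A] (μ0 : ((∀ k, Ω k) × ΩR) → ℝ) {uR : A → ΩR → ℝ}
    {star : ΩR → A} (hstar : ∀ y a, a ≠ star y → uR a y < uR (star y) y)
    {k : Fin n} {π : Ω k × ΩR → A → ℝ} (hπ : IsSignal π) :
    Emax μ0 uR = ∑ a, ∑ ω, jointP μ0 π ω a * uR (star ω.2) ω.2 := by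
  rw [Emax, sum_comm]
  refine sum_congr rfl fun ω _ => ?_
  have hsup : univ.sup' univ_nonempty (fun a => uR a ω.2) = uR (star ω.2) ω.2 := by
    refine le_antisymm (sup'_le _ _ fun a _ => ?_) (le_sup' (fun a => uR a ω.2) (mem_univ _))
    by_cases h : a = star ω.2
    · rw [h]
    · exact (hstar _ a h).le
  simp only [jointP]
  rw [hsup, ← sum_mul, ← mul_sum, hπ.2, mul_one]

lemma vR_le_Emax [Nonempty A] {μ0 : ((∀ k, Ω k) × ΩR) → ℝ} (hμ0 : ∀ ω, 0 ≤ μ0 ω)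
    {uR : A → ΩR → ℝ} {star : ΩR → A} (hstar : ∀ y a, a ≠ star y → uR a y < uR (star y) y)
    {k : Fin n} {π : Ω k × ΩR → A → ℝ} (hπ : IsSignal π) :
    vR μ0 π uR ≤ Emax μ0 uR := by
  rw [Emax_eq_sum_jointP μ0 hstar hπ, vR]
  refine sum_le_sum fun a _ => sum_le_sum fun ω _ =>
    mul_le_mul_of_nonneg_left ?_ (jointP_nonneg hμ0 hπ ω a)
  by_cases h : a = star ω.2
  · rw [← h]
  · exact (hstar _ a h).le

lemma exists_suboptimal_of_vR_lt_Emax [Nonempty A] {μ0 : ((∀ k, Ω k) × ΩR) → ℝ}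
    (hμ0 : ∀ ω, 0 ≤ μ0 ω) {uR : A → ΩR → ℝ} {star : ΩR → A}
    (hstar : ∀ y a, a ≠ star y → uR a y < uR (star y) y)
    {k : Fin n} {π : Ω k × ΩR → A → ℝ} (hπ : IsSignal π) (hlt : vR μ0 π uR < Emax μ0 uR) :
    ∃ ω a, 0 < jointP μ0 π ω a ∧ a ≠ star ω.2 := by
  by_contra! hcon
  refine hlt.ne ?_
  rw [Emax_eq_sum_jointP μ0 hstar hπ, vR]
  refine sum_congr rfl fun a _ => sum_congr rfl fun ω _ => ?_
  rcases (jointP_nonneg hμ0 hπ ω a).eq_or_lt with h | h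
  · rw [← h, zero_mul, zero_mul]
  · rw [← hcon ω a h]

/-- Mixing in full revelation benefits the receiver and changes any sender's payoff
affinely in the weight of the mixture. -/
lemma exists_mixture_with_revelation [Nonempty A] {μ0 : ((∀ k, Ω k) × ΩR) → ℝ}
    (hμ0 : ∀ ω, 0 ≤ μ0 ω) {uR : A → ΩR → ℝ} {star : ΩR → A}
    (hstar : ∀ y a, a ≠ star y → uR a y < uR (star y) y)
    {k : Fin n} {π : Ω k × ΩR → A → ℝ} (hπ : IsSignal π) (hIC : IC μ0 π uR)
    (hlt : vR μ0 π uR < Emax μ0 uR) (uk : A → Ω k → ℝ) :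
    ∃ F : ℝ, ∀ ε : ℝ, 0 < ε → ε ≤ 1 → ∃ π' : Ω k × ΩR → A → ℝ, IsSignal π' ∧ IC μ0 π' uR ∧
      vR μ0 π uR < vR μ0 π' uR ∧ vS μ0 π' k uk = (1 - ε) * vS μ0 π k uk + ε * F := by
  classical
  set ρ : Ω k × ΩR → A → ℝ := fun s a => if a = star s.2 then 1 else 0 with hρdef
  have hρ : IsSignal ρ := by
    refine ⟨fun s a => ?_, fun s => by simp [hρdef]⟩
    simp only [hρdef]
    split_ifs <;> norm_num
  have hρIC : ∀ a b,
      ∑ ω, jointP μ0 ρ ω a * uR b ω.2 ≤ ∑ ω, jointP μ0 ρ ω a * uR a ω.2 := by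
    refine fun a b => sum_le_sum fun ω _ => ?_
    by_cases h : a = star ω.2
    · refine mul_le_mul_of_nonneg_left ?_ (jointP_nonneg hμ0 hρ ω a)
      by_cases hb : b = star ω.2
      · rw [h, hb]
      · rw [h]; exact (hstar _ b hb).le
    · simp [jointP, hρdef, h]
  have hρR : vR μ0 ρ uR = Emax μ0 uR := by
    by_contra hne
    obtain ⟨ω, a, hpos, ha⟩ := exists_suboptimal_of_vR_lt_Emax hμ0 hstar hρ
      (lt_of_le_of_ne (vR_le_Emax hμ0 hstar hρ) hne)
    simp [jointP, hρdef, ha] at hpos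
  refine ⟨vS μ0 ρ k uk, fun ε hε0 hε1 => ?_⟩
  set π' : Ω k × ΩR → A → ℝ := fun s a => (1 - ε) * π s a + ε * ρ s a with hπ'def
  have hπ' : IsSignal π' := by
    refine ⟨fun s a => add_nonneg (mul_nonneg (sub_nonneg.2 hε1) (hπ.1 s a))
      (mul_nonneg hε0.le (hρ.1 s a)), fun s => ?_⟩
    simp only [hπ'def]
    rw [sum_add_distrib, ← mul_sum, ← mul_sum, hπ.2, hρ.2]
    ring
  have hlin : ∀ (a : A) (g : (∀ k, Ω k) × ΩR → ℝ), ∑ ω, jointP μ0 π' ω a * g ω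
      = (1 - ε) * ∑ ω, jointP μ0 π ω a * g ω + ε * ∑ ω, jointP μ0 ρ ω a * g ω := by
    intro a g
    rw [mul_sum, mul_sum, ← sum_add_distrib]
    refine sum_congr rfl fun ω _ => ?_
    simp only [jointP, hπ'def]
    ring
  refine ⟨π', hπ', (IC_iff hμ0 hπ' uR).2 fun a b => ?_, ?_, ?_⟩
  · rw [hlin a (fun ω => uR b ω.2), hlin a (fun ω => uR a ω.2)]
    exact add_le_add
      (mul_le_mul_of_nonneg_left ((IC_iff hμ0 hπ uR).1 hIC a b) (sub_nonneg.2 hε1))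
      (mul_le_mul_of_nonneg_left (hρIC a b) hε0.le)
  · have : vR μ0 π' uR = (1 - ε) * vR μ0 π uR + ε * vR μ0 ρ uR := by
      simp only [vR, mul_sum (s := (univ : Finset A)), ← sum_add_distrib]
      exact sum_congr rfl fun a _ => hlin a (fun ω => uR a ω.2)
    rw [this, hρR]
    nlinarith
  · simp only [vS, mul_sum (s := (univ : Finset A)), ← sum_add_distrib]
    exact sum_congr rfl fun a _ => hlin a (fun ω => uk a (ω.1 k))

/-- If another sender's signal is not first-best for the receiver, then sender `i` has an
incentive compatible signal that both he and the receiver strictly prefer to it. -/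
lemma exists_improving_signal [Nonempty A] [Nonempty ΩR] [∀ k, Nonempty (Ω k)]
    {μ0 : ((∀ k, Ω k) × ΩR) → ℝ} (hμ0 : ∀ ω, 0 ≤ μ0 ω)
    {uR : A → ΩR → ℝ} {u : ∀ k : Fin n, A → Ω k → ℝ}
    (hA1 : Assumption1 uR u) (hA2 : Assumption2 μ0 uR u)
    {i j : Fin n} (hij : i ≠ j) {π : Ω j × ΩR → A → ℝ} (hπ : IsSignal π) (hIC : IC μ0 π uR)
    (hlt : vR μ0 π uR < Emax μ0 uR) (π₀ : Ω i × ΩR → A → ℝ) (hπ₀ : IsSignal π₀) :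
    ∃ π' : Ω i × ΩR → A → ℝ, IsSignal π' ∧ IC μ0 π' uR ∧
      vR μ0 π uR < vR μ0 π' uR ∧ vS μ0 π i (u i) < vS μ0 π' i (u i) := by
  classical
  choose star hargmax hstar using fun y => exists_unique_maximizer (hA1.1 y)
  have hmarg0 : ∀ x y a, 0 ≤ margIR μ0 π i x y a := fun x y a =>
    sum_nonneg fun ω _ => jointP_nonneg hμ0 hπ ω a
  have hmargpos : ∀ ω a, 0 < jointP μ0 π ω a → 0 < margIR μ0 π i (ω.1 i) ω.2 a := by
    intro ω a h
    exact sum_pos' (fun ω _ => jointP_nonneg hμ0 hπ ω a) ⟨ω, by simp, h⟩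
  have hR : ∀ {k : Fin n} (π : Ω k × ΩR → A → ℝ) (a b : A),
      ∑ ω, jointP μ0 π ω a * uR b ω.2 = ∑ x, ∑ y, margIR μ0 π i x y a * uR b y :=
    fun π a b => sum_jointP_mul μ0 π i a (fun _ y => uR b y)
  have hS : ∀ {k : Fin n} (π : Ω k × ΩR → A → ℝ) (a : A),
      ∑ ω, jointP μ0 π ω a * u i a (ω.1 i) = ∑ x, ∑ y, margIR μ0 π i x y a * u i a x :=
    fun π a => sum_jointP_mul μ0 π i a (fun x _ => u i a x)
  have halign : ∀ y a, (∃ x, 0 < margIR μ0 π i x y a) →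
      ∃ x, 0 < margIR μ0 π i x y a ∧ ∀ b, b ≠ star y → u i b x < u i (star y) x := by
    rintro y a ⟨x, hx⟩
    obtain ⟨ω, hω, hωpos⟩ := exists_lt_of_sum_lt (by simpa [margIR] using hx :
      ∑ ω ∈ univ.filter (fun ω : (∀ k, Ω k) × ΩR => ω.1 i = x ∧ ω.2 = y), (0 : ℝ) < _)
    simp only [mem_filter, mem_univ, true_and] at hω
    have hμω : 0 < μ0 ω := pos_of_mul_pos_left hωpos (hπ.1 _ _)
    have hπω : 0 < π (ω.1 j, y) a := by
      rw [← hω.2]; exact pos_of_mul_pos_right hωpos (hμ0 ω)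
    obtain ⟨x', hx', hagree⟩ := hA2 i j hij (ω.1 j) y
      (sum_pos' (fun ω _ => hμ0 ω) ⟨ω, by simp [hω.2], hμω⟩)
    obtain ⟨ω', hω', hωpos'⟩ := exists_lt_of_sum_lt (by simpa using hx' :
      ∑ ω' ∈ univ.filter (fun ω' : (∀ k, Ω k) × ΩR =>
        ω'.1 i = x' ∧ ω'.1 j = ω.1 j ∧ ω'.2 = y), (0 : ℝ) < _)
    simp only [mem_filter, mem_univ, true_and] at hω'
    refine ⟨x', ?_, ?_⟩
    · have := hmargpos ω' a (mul_pos hωpos' (by rw [hω'.2.1, hω'.2.2]; exact hπω))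
      rwa [hω'.1, hω'.2.2] at this
    · obtain ⟨s, hs, hsmax⟩ := exists_unique_maximizer (hA1.2 i x')
      have hsy : s = star y := singleton_injective (hs.symm.trans (hagree.trans (hargmax y)))
      rwa [hsy] at hsmax
  obtain ⟨ω, a, hpos, ha⟩ := exists_suboptimal_of_vR_lt_Emax hμ0 hstar hπ hlt
  obtain ⟨q, hq0, hqsum, hqIC, hqR, hqS⟩ := exists_improved_joint
    (fun x y a => margIR μ0 π i x y a) hmarg0 uR (u i) star hstar halign
    (fun a b => by rw [← hR, ← hR]; exact (IC_iff hμ0 hπ uR).1 hIC a b)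
    ⟨ω.1 i, ω.2, a, hmargpos ω a hpos, ha⟩
  obtain ⟨π', hπ', hπq⟩ := exists_signal_of_joint (μ0 := μ0) π₀ hπ₀ q hq0
    fun x y => (hqsum x y).trans (sum_margIR μ0 hπ i x y)
  refine ⟨π', hπ', (IC_iff hμ0 hπ' uR).2 fun a b => ?_, ?_, ?_⟩
  · simpa only [hR, hπq] using hqIC a b
  · simpa only [vR, hR, hπq] using hqR
  · simpa only [vS, hS, hπq] using hqS

lemma senderPayoff_update_of_vR_lt {μ0 : ((∀ k, Ω k) × ΩR) → ℝ}
    {π : ∀ k : Fin n, Ω k × ΩR → A → ℝ} {uR : A → ΩR → ℝ} {i : Fin n}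
    {π' : Ω i × ΩR → A → ℝ} (h : ∀ k, vR μ0 (π k) uR < vR μ0 π' uR) (ui : A → Ω i → ℝ) :
    senderPayoff μ0 (Function.update π i π') uR i ui = vS μ0 π' i ui := by
  have hbest : BestSet μ0 (Function.update π i π') uR = {i} := by
    ext j
    simp only [BestSet, mem_filter, mem_univ, true_and, mem_singleton]
    constructor
    · intro hj
      by_contra hji
      have := hj i
      rw [Function.update_self, Function.update_of_ne hji] at this
      exact absurd (h j) (not_lt.2 this)
    · rintro rfl k
      rw [Function.update_self]
      by_cases hk : k = j
      · subst hk
        rw [Function.update_self]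
      · rw [Function.update_of_ne hk]
        exact (h k).le
  rw [senderPayoff, hbest]
  simp

/-- with at least two senders and under Assumptions 1 and 2, in every pure Nash
equilibrium of the persuasion game with the uniform tie-breaking decision rule, the
receiver's expected equilibrium payoff equals his first-best `E_{μ0}[max_a u_R(a, ω_R)]`. -/
theorem receiver_reaps_surplus_pure
    [Nonempty A] [Nonempty ΩR] [∀ k, Nonempty (Ω k)]
    (hn : 2 ≤ n)
    (μ0 : ((∀ k, Ω k) × ΩR) → ℝ)
    (hμ0 : ∀ ω, 0 ≤ μ0 ω) (hμ1 : ∑ ω, μ0 ω = 1)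
    (uR : A → ΩR → ℝ) (u : ∀ k : Fin n, A → Ω k → ℝ)
    (hA1 : Assumption1 uR u) (hA2 : Assumption2 μ0 uR u)
    (π : ∀ k : Fin n, Ω k × ΩR → A → ℝ)
    (hNE : PureNE μ0 π uR u) :
    (∑ j ∈ BestSet μ0 π uR, vR μ0 (π j) uR) / (BestSet μ0 π uR).card
      = Emax μ0 uR := by
  choose star _ hstar using fun y => exists_unique_maximizer (hA1.1 y)
  obtain ⟨hsig, hdev⟩ := hNE
  have : Nonempty (Fin n) := ⟨⟨0, by omega⟩⟩
  have : Nontrivial (Fin n) := Fin.nontrivial_iff_two_le.2 hn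
  obtain ⟨j, hj⟩ := Finite.exists_max fun k => vR μ0 (π k) uR
  have hjB : j ∈ BestSet μ0 π uR := by simpa [BestSet] using hj
  have hcard : (0 : ℝ) < (BestSet μ0 π uR).card := by exact_mod_cast card_pos.2 ⟨j, hjB⟩
  have hB : ∀ k ∈ BestSet μ0 π uR, vR μ0 (π k) uR = vR μ0 (π j) uR := by
    intro k hk
    refine le_antisymm (hj k) ?_
    simp only [BestSet, mem_filter, mem_univ, true_and] at hk
    exact hk j
  rw [sum_congr rfl hB, sum_const, nsmul_eq_mul, mul_div_cancel_left₀ _ hcard.ne']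
  refine le_antisymm (vR_le_Emax hμ0 hstar (hsig j).1) (not_lt.1 fun hlt => ?_)
  have hbound : ∀ (i : Fin n) (π' : Ω i × ΩR → A → ℝ), IsSignal π' → IC μ0 π' uR →
      vR μ0 (π j) uR < vR μ0 π' uR → vS μ0 π' i (u i) ≤ senderPayoff μ0 π uR i (u i) := by
    intro i π' h1 h2 h3
    rw [← senderPayoff_update_of_vR_lt (fun k => (hj k).trans_lt h3) (u i)]
    exact hdev i π' h1 h2
  obtain ⟨i, hij⟩ := exists_ne j
  have hother : ∀ k ∈ BestSet μ0 π uR, i ≠ k →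
      vS μ0 (π k) i (u i) < senderPayoff μ0 π uR i (u i) := by
    intro k hk hik
    obtain ⟨π', h1, h2, h3, h4⟩ := exists_improving_signal hμ0 hA1 hA2 hik (hsig k).1 (hsig k).2
      (by rwa [hB k hk]) (π i) (hsig i).1
    exact h4.trans_le (hbound i π' h1 h2 (by rwa [hB k hk] at h3))
  have hown : i ∈ BestSet μ0 π uR → vS μ0 (π i) i (u i) ≤ senderPayoff μ0 π uR i (u i) := by
    intro hi
    obtain ⟨F, hF⟩ := exists_mixture_with_revelation hμ0 hstar (hsig i).1 (hsig i).2
      (by rwa [hB i hi]) (u i)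
    have hmix : ∀ ε : ℝ, 0 < ε → ε ≤ 1 →
        (1 - ε) * vS μ0 (π i) i (u i) + ε * F ≤ senderPayoff μ0 π uR i (u i) := by
      intro ε hε0 hε1
      obtain ⟨π', h1, h2, h3, h4⟩ := hF ε hε0 hε1
      rw [← h4]
      exact hbound i π' h1 h2 (by rwa [hB i hi] at h3)
    have hlim : Filter.Tendsto (fun ε : ℝ => (1 - ε) * vS μ0 (π i) i (u i) + ε * F)
        (nhdsWithin 0 (Set.Ioi 0)) (nhds (vS μ0 (π i) i (u i))) := by
      have hcont : Continuous fun ε : ℝ => (1 - ε) * vS μ0 (π i) i (u i) + ε * F := by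
        fun_prop
      have := hcont.tendsto 0
      simp only [sub_zero, one_mul, zero_mul, add_zero] at this
      exact this.mono_left nhdsWithin_le_nhds
    refine le_of_tendsto hlim ?_
    filter_upwards [Ioc_mem_nhdsGT (zero_lt_one' ℝ)] with ε hε using hmix ε hε.1 hε.2
  have hsum : ∑ k ∈ BestSet μ0 π uR, vS μ0 (π k) i (u i)
      < ∑ _k ∈ BestSet μ0 π uR, senderPayoff μ0 π uR i (u i) := by
    refine sum_lt_sum (fun k hk => ?_) ⟨j, hjB, hother j hjB hij⟩
    by_cases hik : i = k
    · subst hik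
      exact hown hk
    · exact (hother k hk hik).le
  rw [sum_const, nsmul_eq_mul, senderPayoff, mul_div_cancel₀ _ hcard.ne'] at hsum
  exact lt_irrefl _ hsum

end Persuasion
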